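/- In every proper 5-coloring of the 600-cell graph Σ, antipodal vertices receive the same color: if f : V → Fin 5 satisfies f q ≠ f q' for all adjacent q, q', then f (−q) = f q for every q ∈ V. (This is the paper's statement that the map φ : Σ⁶ → B²(Σ⁶) identifies v with −v, so that it is two-to-one.) -/

import Mathlib

/-- The golden ratio. -/
noncomputable def gr : ℝ := (1 + Real.sqrt 5) / 2

/-- The coefficient 4-tuple of a quaternion with respect to the basis (1, i, j, k). -/
def coords (q : Quaternion ℝ) : Fin 4 → ℝ := ![q.re, q.imI, q.imJ, q.imK]

/-- `x` is a sign, i.e. `x = ±1`. -/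
def IsSign (x : ℝ) : Prop := x = 1 ∨ x = -1

/-- The 120 vertices of the regular 600-cell of circumradius 1: the eight unit quaternions
`±1, ±i, ±j, ±k`, the sixteen quaternions `½(±1 ± i ± j ± k)`, and the ninety-six quaternions
whose coefficient 4-tuple is an even permutation of `(±φ/2, ±1/2, ±1/(2φ), 0)`. -/
noncomputable def V600 : Set (Quaternion ℝ) :=
  {q | (∃ ε : ℝ, IsSign ε ∧
          (coords q = ![ε, 0, 0, 0] ∨ coords q = ![0, ε, 0, 0] ∨
           coords q = ![0, 0, ε, 0] ∨ coords q = ![0, 0, 0, ε])) ∨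
       (∃ ε₀ ε₁ ε₂ ε₃ : ℝ, IsSign ε₀ ∧ IsSign ε₁ ∧ IsSign ε₂ ∧ IsSign ε₃ ∧
          coords q = ![ε₀ / 2, ε₁ / 2, ε₂ / 2, ε₃ / 2]) ∨
       (∃ ε₁ ε₂ ε₃ : ℝ, IsSign ε₁ ∧ IsSign ε₂ ∧ IsSign ε₃ ∧
          ∃ σ : Equiv.Perm (Fin 4), Equiv.Perm.sign σ = 1 ∧
            coords q = ![ε₁ * gr / 2, ε₂ / 2, ε₃ / (2 * gr), 0] ∘ σ)}

/-- The 600-cell graph: distinct vertices are adjacent iff their distance is `φ - 1`. -/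
noncomputable def sigma600 : SimpleGraph V600 :=
  SimpleGraph.fromRel fun q q' => ‖(q : Quaternion ℝ) - (q' : Quaternion ℝ)‖ = gr - 1


/-- The quaternion `½ ∑ (aₙ + bₙ φ) eₙ`, stored through its integer coefficients. -/
@[ext]
structure Icosian where
  (a₀ b₀ a₁ b₁ a₂ b₂ a₃ b₃ : ℤ)
deriving DecidableEq

namespace Icosian

/-- The real quaternion represented by integer coefficients. -/
noncomputable def toQuaternion (x : Icosian) : Quaternion ℝ :=
  ⟨(x.a₀ + x.b₀ * gr) / 2, (x.a₁ + x.b₁ * gr) / 2,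
    (x.a₂ + x.b₂ * gr) / 2, (x.a₃ + x.b₃ * gr) / 2⟩

/-- The coefficients of twice the product. -/
def twoMul (x y : Icosian) : Icosian where
  a₀ := x.a₀ * y.a₀ + x.b₀ * y.b₀ - (x.a₁ * y.a₁ + x.b₁ * y.b₁)
    - (x.a₂ * y.a₂ + x.b₂ * y.b₂) - (x.a₃ * y.a₃ + x.b₃ * y.b₃)
  b₀ := x.a₀ * y.b₀ + x.b₀ * y.a₀ + x.b₀ * y.b₀ - (x.a₁ * y.b₁ + x.b₁ * y.a₁ + x.b₁ * y.b₁)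
    - (x.a₂ * y.b₂ + x.b₂ * y.a₂ + x.b₂ * y.b₂) - (x.a₃ * y.b₃ + x.b₃ * y.a₃ + x.b₃ * y.b₃)
  a₁ := x.a₀ * y.a₁ + x.b₀ * y.b₁ + (x.a₁ * y.a₀ + x.b₁ * y.b₀)
    + (x.a₂ * y.a₃ + x.b₂ * y.b₃) - (x.a₃ * y.a₂ + x.b₃ * y.b₂)
  b₁ := x.a₀ * y.b₁ + x.b₀ * y.a₁ + x.b₀ * y.b₁ + (x.a₁ * y.b₀ + x.b₁ * y.a₀ + x.b₁ * y.b₀)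
    + (x.a₂ * y.b₃ + x.b₂ * y.a₃ + x.b₂ * y.b₃) - (x.a₃ * y.b₂ + x.b₃ * y.a₂ + x.b₃ * y.b₂)
  a₂ := x.a₀ * y.a₂ + x.b₀ * y.b₂ - (x.a₁ * y.a₃ + x.b₁ * y.b₃)
    + (x.a₂ * y.a₀ + x.b₂ * y.b₀) + (x.a₃ * y.a₁ + x.b₃ * y.b₁)
  b₂ := x.a₀ * y.b₂ + x.b₀ * y.a₂ + x.b₀ * y.b₂ - (x.a₁ * y.b₃ + x.b₁ * y.a₃ + x.b₁ * y.b₃)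
    + (x.a₂ * y.b₀ + x.b₂ * y.a₀ + x.b₂ * y.b₀) + (x.a₃ * y.b₁ + x.b₃ * y.a₁ + x.b₃ * y.b₁)
  a₃ := x.a₀ * y.a₃ + x.b₀ * y.b₃ + (x.a₁ * y.a₂ + x.b₁ * y.b₂)
    - (x.a₂ * y.a₁ + x.b₂ * y.b₁) + (x.a₃ * y.a₀ + x.b₃ * y.b₀)
  b₃ := x.a₀ * y.b₃ + x.b₀ * y.a₃ + x.b₀ * y.b₃ + (x.a₁ * y.b₂ + x.b₁ * y.a₂ + x.b₁ * y.b₂)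
    - (x.a₂ * y.b₁ + x.b₂ * y.a₁ + x.b₂ * y.b₁) + (x.a₃ * y.b₀ + x.b₃ * y.a₀ + x.b₃ * y.b₀)

/-- The product, meaningful when `twoMul x y` has even coefficients. -/
def mul (x y : Icosian) : Icosian :=
  let z := twoMul x y
  ⟨z.a₀ / 2, z.b₀ / 2, z.a₁ / 2, z.b₁ / 2, z.a₂ / 2, z.b₂ / 2, z.a₃ / 2, z.b₃ / 2⟩

/-- Coefficientwise doubling. -/
def double (x : Icosian) : Icosian :=
  ⟨2 * x.a₀, 2 * x.b₀, 2 * x.a₁, 2 * x.b₁, 2 * x.a₂, 2 * x.b₂, 2 * x.a₃, 2 * x.b₃⟩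

/-- Negation. -/
def neg (x : Icosian) : Icosian :=
  ⟨-x.a₀, -x.b₀, -x.a₁, -x.b₁, -x.a₂, -x.b₂, -x.a₃, -x.b₃⟩

/-- Quaternionic conjugation. -/
def conj (x : Icosian) : Icosian :=
  ⟨x.a₀, x.b₀, -x.a₁, -x.b₁, -x.a₂, -x.b₂, -x.a₃, -x.b₃⟩

/-- Coefficientwise subtraction. -/
def sub (x y : Icosian) : Icosian :=
  ⟨x.a₀ - y.a₀, x.b₀ - y.b₀, x.a₁ - y.a₁, x.b₁ - y.b₁,
    x.a₂ - y.a₂, x.b₂ - y.b₂, x.a₃ - y.a₃, x.b₃ - y.b₃⟩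

/-- The pair `(m, n)` such that four times the squared norm is `m + n φ`. -/
def fourNormSq (x : Icosian) : ℤ × ℤ :=
  (x.a₀ * x.a₀ + x.b₀ * x.b₀ + (x.a₁ * x.a₁ + x.b₁ * x.b₁)
    + (x.a₂ * x.a₂ + x.b₂ * x.b₂) + (x.a₃ * x.a₃ + x.b₃ * x.b₃),
   2 * x.a₀ * x.b₀ + x.b₀ * x.b₀ + (2 * x.a₁ * x.b₁ + x.b₁ * x.b₁)
    + (2 * x.a₂ * x.b₂ + x.b₂ * x.b₂) + (2 * x.a₃ * x.b₃ + x.b₃ * x.b₃))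

/-- The unit `1`. -/
def one : Icosian := ⟨2, 0, 0, 0, 0, 0, 0, 0⟩

/-- The icosian with the given coordinates in `½ ℤ[φ]`. -/
def ofCoords (p : Fin 4 → ℤ × ℤ) : Icosian :=
  ⟨(p 0).1, (p 0).2, (p 1).1, (p 1).2, (p 2).1, (p 2).2, (p 3).1, (p 3).2⟩

/-- The twelve even permutations of four indices. -/
def evenMaps : List (Fin 4 → Fin 4) :=
  [![0, 1, 2, 3], ![0, 2, 3, 1], ![0, 3, 1, 2], ![1, 0, 3, 2], ![1, 3, 2, 0], ![1, 2, 0, 3],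
   ![2, 0, 1, 3], ![2, 1, 3, 0], ![2, 3, 0, 1], ![3, 0, 2, 1], ![3, 2, 1, 0], ![3, 1, 0, 2]]

/-- The two signs. -/
def signs : List ℤ := [1, -1]

/-- The vertices of the 600-cell. -/
def vertexList : List Icosian :=
  (signs.flatMap fun e => let p := (2 * e, 0)
    [ofCoords ![p, 0, 0, 0], ofCoords ![0, p, 0, 0], ofCoords ![0, 0, p, 0],
      ofCoords ![0, 0, 0, p]]) ++
  (signs.flatMap fun e₀ => signs.flatMap fun e₁ => signs.flatMap fun e₂ => signs.map fun e₃ =>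
    ofCoords ![(e₀, 0), (e₁, 0), (e₂, 0), (e₃, 0)]) ++
  (signs.flatMap fun e₁ => signs.flatMap fun e₂ => signs.flatMap fun e₃ =>
    evenMaps.map fun m => ofCoords (![(0, e₁), (e₂, 0), (-e₃, e₃), 0] ∘ m))

/-- The vertices of the 600-cell, as a finite set. -/
def vertices : Finset Icosian := ⟨vertexList, by decide +kernel⟩

/-- The neighbours of `1` in the 600-cell. -/
def units : Finset Icosian := vertices.filter fun x => x.a₀ = 0 ∧ x.b₀ = 1

/-- An odd class function supported away from the purely imaginary vertices. -/
def weight (x : Icosian) : ℤ :=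
  if x.a₀ = 0 then -x.b₀
  else if x.b₀ = 0 then (if x.a₀ = 2 then 10 else if x.a₀ = -2 then -10 else -x.a₀)
  else 3 * x.b₀

/-- Position of the real part among the nine values it takes, in decreasing order. -/
def height (x : Icosian) : ℕ :=
  if x.b₀ = 0 then (if x.a₀ = 2 then 0 else if x.a₀ = 1 then 2 else if x.a₀ = 0 then 4 else
    if x.a₀ = -1 then 6 else 8)
  else if x.a₀ = 0 then (if x.b₀ = 1 then 1 else 7) else (if x.b₀ = 1 then 3 else 5)

theorem card_units : units.card = 12 := by decide +kernel

theorem one_mem : one ∈ vertices := by decide +kernel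

theorem neg_mem : ∀ x ∈ vertices, neg x ∈ vertices := by decide +kernel

theorem mul_mem : ∀ x ∈ vertices, ∀ t ∈ units, mul x t ∈ vertices := by decide +kernel

theorem double_mul : ∀ x ∈ vertices, ∀ t ∈ units, double (mul x t) = twoMul x t := by
  decide +kernel

theorem conj_mem_units : ∀ t ∈ units, conj t ∈ units := by decide +kernel

theorem exists_height_mul_lt :
    ∀ x ∈ vertices, x = one ∨ ∃ t ∈ units, height (mul x t) < height x := by
  decide +kernel

theorem fourNormSq_of_mem : ∀ x ∈ vertices, fourNormSq x = (4, 0) := by decide +kernel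

theorem fourNormSq_one_sub : ∀ t ∈ units, fourNormSq (sub one t) = (8, -4) := by decide +kernel

/-- Among any four vertices of the icosahedron, two are adjacent. -/
theorem exists_adj_of_card_eq_four : ∀ I ∈ units.powersetCard 4,
    ∃ s ∈ I, ∃ t ∈ I, fourNormSq (sub s t) = (8, -4) := by decide +kernel

theorem sum_weight : ∑ x ∈ vertices, weight x = 0 := by decide +kernel

/-- On the weight function, adjacency operator plus three gives a multiple of `δ₁ - δ₋₁`. -/
theorem sum_weight_mul : ∀ x ∈ vertices, ∑ t ∈ units, weight (mul x t) + 3 * weight x =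
    (if x = one then 18 else 0) - (if x = neg one then 18 else 0) := by
  decide +kernel

theorem mem_vertices {x : Icosian} : x ∈ vertices ↔
    (∃ e ∈ signs, x = ofCoords ![(2 * e, 0), 0, 0, 0] ∨ x = ofCoords ![0, (2 * e, 0), 0, 0] ∨
      x = ofCoords ![0, 0, (2 * e, 0), 0] ∨ x = ofCoords ![0, 0, 0, (2 * e, 0)]) ∨
    (∃ e₀ ∈ signs, ∃ e₁ ∈ signs, ∃ e₂ ∈ signs, ∃ e₃ ∈ signs,
      x = ofCoords ![(e₀, 0), (e₁, 0), (e₂, 0), (e₃, 0)]) ∨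
    (∃ e₁ ∈ signs, ∃ e₂ ∈ signs, ∃ e₃ ∈ signs, ∃ m ∈ evenMaps,
      x = ofCoords (![(0, e₁), (e₂, 0), (-e₃, e₃), 0] ∘ m)) := by
  change x ∈ vertexList ↔ _
  simp only [vertexList, List.mem_append, List.mem_flatMap, List.mem_map, List.mem_cons,
    List.not_mem_nil, or_false, or_assoc, eq_comm (b := x)]

attribute [irreducible] vertices units

theorem gr_sq : gr * gr = gr + 1 := by
  have h : Real.sqrt 5 * Real.sqrt 5 = 5 := Real.mul_self_sqrt (by norm_num)
  unfold gr
  linear_combination h / 4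

theorem one_lt_gr : 1 < gr := by
  have h : 1 < Real.sqrt 5 := by
    rw [Real.lt_sqrt (by norm_num)]
    norm_num
  unfold gr
  linarith

@[simp]
theorem re_toQuaternion (x : Icosian) : (toQuaternion x).re = (x.a₀ + x.b₀ * gr) / 2 := rfl

@[simp]
theorem imI_toQuaternion (x : Icosian) : (toQuaternion x).imI = (x.a₁ + x.b₁ * gr) / 2 := rfl

@[simp]
theorem imJ_toQuaternion (x : Icosian) : (toQuaternion x).imJ = (x.a₂ + x.b₂ * gr) / 2 := rfl

@[simp]
theorem imK_toQuaternion (x : Icosian) : (toQuaternion x).imK = (x.a₃ + x.b₃ * gr) / 2 := rfl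

theorem toQuaternion_twoMul (x y : Icosian) :
    toQuaternion (twoMul x y) = (2 : ℝ) • (toQuaternion x * toQuaternion y) := by
  have h := gr_sq
  ext
  · simp [twoMul]
    linear_combination (-(x.b₀ * y.b₀ - x.b₁ * y.b₁ - x.b₂ * y.b₂ - x.b₃ * y.b₃) / 2 : ℝ) * h
  · simp [twoMul]
    linear_combination (-(x.b₀ * y.b₁ + x.b₁ * y.b₀ + x.b₂ * y.b₃ - x.b₃ * y.b₂) / 2 : ℝ) * h
  · simp [twoMul]
    linear_combination (-(x.b₀ * y.b₂ - x.b₁ * y.b₃ + x.b₂ * y.b₀ + x.b₃ * y.b₁) / 2 : ℝ) * h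
  · simp [twoMul]
    linear_combination (-(x.b₀ * y.b₃ + x.b₁ * y.b₂ - x.b₂ * y.b₁ + x.b₃ * y.b₀) / 2 : ℝ) * h

theorem toQuaternion_double (x : Icosian) :
    toQuaternion (double x) = (2 : ℝ) • toQuaternion x := by
  ext <;> simp [double] <;> ring

theorem toQuaternion_mul {x t : Icosian} (hx : x ∈ vertices) (ht : t ∈ units) :
    toQuaternion (mul x t) = toQuaternion x * toQuaternion t := by
  have h := toQuaternion_double (mul x t)
  rw [double_mul x hx t ht, toQuaternion_twoMul] at h
  exact (smul_right_injective _ (two_ne_zero' ℝ) h).symm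

theorem toQuaternion_one : toQuaternion one = 1 := by
  ext <;> simp [one] <;> rfl

theorem toQuaternion_neg (x : Icosian) : toQuaternion (neg x) = -toQuaternion x := by
  ext <;> simp [neg] <;> ring

theorem toQuaternion_sub (x y : Icosian) :
    toQuaternion (sub x y) = toQuaternion x - toQuaternion y := by
  ext <;> simp [sub] <;> ring

theorem norm_toQuaternion_sq (x : Icosian) :
    ‖toQuaternion x‖ ^ 2 = ((fourNormSq x).1 + (fourNormSq x).2 * gr) / 4 := by
  rw [sq, ← Quaternion.normSq_eq_norm_mul_self, Quaternion.normSq_def']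
  simp only [re_toQuaternion, imI_toQuaternion, imJ_toQuaternion, imK_toQuaternion, fourNormSq]
  push_cast
  linear_combination
    ((x.b₀ * x.b₀ + x.b₁ * x.b₁ + x.b₂ * x.b₂ + x.b₃ * x.b₃) / 4 : ℝ) * gr_sq

theorem norm_toQuaternion {x : Icosian} (hx : x ∈ vertices) : ‖toQuaternion x‖ = 1 := by
  have h := norm_toQuaternion_sq x
  rw [fourNormSq_of_mem x hx] at h
  rw [← sq_eq_sq₀ (norm_nonneg _) zero_le_one, h]
  norm_num

theorem norm_sub_eq {x y : Icosian} (h : fourNormSq (sub x y) = (8, -4)) :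
    ‖toQuaternion x - toQuaternion y‖ = gr - 1 := by
  rw [← toQuaternion_sub, ← sq_eq_sq₀ (norm_nonneg _) (by linarith [one_lt_gr]),
    norm_toQuaternion_sq, h]
  push_cast
  linear_combination -gr_sq

theorem conj_conj (x : Icosian) : conj (conj x) = x := by
  simp [conj]

theorem mem_of_mem_units {t : Icosian} (ht : t ∈ units) : t ∈ vertices := by
  unfold units at ht
  exact (Finset.mem_filter.1 ht).1

theorem mul_mul_conj {x t : Icosian} (hx : x ∈ vertices) (ht : t ∈ units) :
    mul (mul x t) (conj t) = x := by
  have h₁ := double_mul _ (mul_mem x hx t ht) _ (conj_mem_units t ht)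
  have h₂ := double_mul x hx t ht
  have h₃ := fourNormSq_of_mem t (mem_of_mem_units ht)
  simp only [fourNormSq, Prod.mk.injEq] at h₃
  obtain ⟨hm, hn⟩ := h₃
  have h₄ : double (twoMul (mul x t) (conj t)) = double (double x) := by
    have : double (twoMul (mul x t) (conj t)) = twoMul (double (mul x t)) (conj t) := by
      ext <;> simp only [double, twoMul] <;> ring
    rw [this, h₂]
    ext <;> simp only [double, twoMul, conj]
    · linear_combination x.a₀ * hm + x.b₀ * hn
    · linear_combination x.b₀ * hm + (x.a₀ + x.b₀) * hn
    · linear_combination x.a₁ * hm + x.b₁ * hn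
    · linear_combination x.b₁ * hm + (x.a₁ + x.b₁) * hn
    · linear_combination x.a₂ * hm + x.b₂ * hn
    · linear_combination x.b₂ * hm + (x.a₂ + x.b₂) * hn
    · linear_combination x.a₃ * hm + x.b₃ * hn
    · linear_combination x.b₃ * hm + (x.a₃ + x.b₃) * hn
  have double_injective : Function.Injective double := by
    intro y z hyz
    simp only [double, Icosian.mk.injEq] at hyz
    ext <;> omega
  exact double_injective (h₁.trans (double_injective h₄))

/-- A colouring of the quaternions that is proper on the vertices of the 600-cell. -/
def IsProper (g : Quaternion ℝ → Fin 5) : Prop :=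
  ∀ x ∈ vertices, ∀ y ∈ vertices, ‖toQuaternion x - toQuaternion y‖ = gr - 1 →
    g (toQuaternion x) ≠ g (toQuaternion y)

theorem IsProper.mul_right {g : Quaternion ℝ → Fin 5} (hg : IsProper g) {t : Icosian}
    (ht : t ∈ units) : IsProper fun q => g (q * toQuaternion t) := by
  intro x hx y hy hxy
  have h := hg _ (mul_mem x hx t ht) _ (mul_mem y hy t ht)
  rw [toQuaternion_mul hx ht, toQuaternion_mul hy ht, ← sub_mul, norm_mul,
    norm_toQuaternion (mem_of_mem_units ht), mul_one] at h
  exact h hxy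

theorem IsProper.card_fiber_le {g : Quaternion ℝ → Fin 5} (hg : IsProper g) {x : Icosian}
    (hx : x ∈ vertices) (c : Fin 5) :
    (units.filter fun t => g (toQuaternion (mul x t)) = c).card ≤ 3 := by
  by_contra! h
  obtain ⟨I, hI, hcard⟩ := Finset.exists_subset_card_eq h
  obtain ⟨s, hs, t, ht, hst⟩ := exists_adj_of_card_eq_four I
    (Finset.mem_powersetCard.2 ⟨hI.trans (Finset.filter_subset _ _), hcard⟩)
  obtain ⟨hs, hsc⟩ := Finset.mem_filter.1 (hI hs)
  obtain ⟨ht, htc⟩ := Finset.mem_filter.1 (hI ht)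
  refine hg _ (mul_mem x hx s hs) _ (mul_mem x hx t ht) ?_ (hsc.trans htc.symm)
  rw [toQuaternion_mul hx hs, toQuaternion_mul hx ht, ← mul_sub, norm_mul,
    norm_toQuaternion hx, one_mul, norm_sub_eq hst]

theorem IsProper.mul_ne {g : Quaternion ℝ → Fin 5} (hg : IsProper g) {x t : Icosian}
    (hx : x ∈ vertices) (ht : t ∈ units) :
    g (toQuaternion (mul x t)) ≠ g (toQuaternion x) := by
  refine (hg _ hx _ (mul_mem x hx t ht) ?_).symm
  have h : toQuaternion x - toQuaternion (mul x t) =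
      toQuaternion x * (toQuaternion one - toQuaternion t) := by
    rw [toQuaternion_mul hx ht, toQuaternion_one, mul_sub, mul_one]
  rw [h, norm_mul, norm_toQuaternion hx, one_mul, norm_sub_eq (fourNormSq_one_sub t ht)]

/-- Every colour other than that of `x` occurs exactly three times around `x`. -/
theorem IsProper.sum_indicator {g : Quaternion ℝ → Fin 5} (hg : IsProper g) {x : Icosian}
    (hx : x ∈ vertices) (c : Fin 5) :
    ∑ t ∈ units, (if g (toQuaternion (mul x t)) = c then 1 else 0 : ℤ) +
      3 * (if g (toQuaternion x) = c then 1 else 0) = 3 := by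
  set n : Fin 5 → ℕ := fun c => (units.filter fun t => g (toQuaternion (mul x t)) = c).card
    with hn
  have h_sum : ∑ c, n c = 12 := by
    rw [← card_units]
    exact (Finset.card_eq_sum_card_fiberwise fun _ _ => Finset.mem_coe.2 (Finset.mem_univ _)).symm
  have h_zero : n (g (toQuaternion x)) = 0 := by
    rw [hn, Finset.card_eq_zero, Finset.filter_eq_empty_iff]
    exact fun t ht => hg.mul_ne hx ht
  have h_nonneg : ∀ d ∈ Finset.univ,
      0 ≤ (3 - (n d + 3 * (if g (toQuaternion x) = d then 1 else 0)) : ℤ) := by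
    intro d _
    have := hg.card_fiber_le hx d
    split_ifs with h
    · subst h
      simp [h_zero]
    · change n d ≤ 3 at this
      omega
  have h_total :
      ∑ d, (3 - (n d + 3 * (if g (toQuaternion x) = d then 1 else 0)) : ℤ) = 0 := by
    rw [Finset.sum_sub_distrib, Finset.sum_add_distrib, ← Finset.mul_sum, ← Nat.cast_sum, h_sum]
    simp
  have h := (Finset.sum_eq_zero_iff_of_nonneg h_nonneg).1 h_total c (Finset.mem_univ c)
  rw [Finset.sum_boole]
  change (n c : ℤ) + _ = 3
  linarith

/-- The adjacency operator is symmetric. -/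
theorem sum_sum_mul_comm (a b : Icosian → ℤ) :
    ∑ x ∈ vertices, ∑ t ∈ units, a (mul x t) * b x =
      ∑ x ∈ vertices, ∑ t ∈ units, a x * b (mul x t) := by
  rw [← Finset.sum_product', ← Finset.sum_product']
  have h_maps : ∀ p ∈ vertices ×ˢ units, (mul p.1 p.2, conj p.2) ∈ vertices ×ˢ units := by
    intro p hp
    obtain ⟨hx, ht⟩ := Finset.mem_product.1 hp
    exact Finset.mem_product.2 ⟨mul_mem _ hx _ ht, conj_mem_units _ ht⟩
  have h_inv : ∀ p ∈ vertices ×ˢ units, (mul (mul p.1 p.2) (conj p.2), conj (conj p.2)) = p := by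
    intro p hp
    obtain ⟨hx, ht⟩ := Finset.mem_product.1 hp
    rw [mul_mul_conj hx ht, conj_conj]
  refine Finset.sum_nbij' (fun p => (mul p.1 p.2, conj p.2)) (fun p => (mul p.1 p.2, conj p.2))
    h_maps h_maps h_inv h_inv ?_
  intro p hp
  obtain ⟨hx, ht⟩ := Finset.mem_product.1 hp
  rw [mul_mul_conj hx ht]

theorem IsProper.apply_neg_one {g : Quaternion ℝ → Fin 5} (hg : IsProper g) :
    g (-1) = g 1 := by
  set b : Icosian → ℤ := fun x => if g (toQuaternion x) = g 1 then 1 else 0 with hb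
  have h_left : ∑ x ∈ vertices, (∑ t ∈ units, weight (mul x t) + 3 * weight x) * b x =
      18 * b one - 18 * b (neg one) := by
    rw [Finset.sum_congr rfl fun x hx => by rw [sum_weight_mul x hx]]
    simp [sub_mul, Finset.sum_sub_distrib, ite_mul, one_mem, neg_mem one one_mem]
  have h_right : ∑ x ∈ vertices, (∑ t ∈ units, weight (mul x t) + 3 * weight x) * b x = 0 := by
    calc _ = ∑ x ∈ vertices, weight x * (∑ t ∈ units, b (mul x t) + 3 * b x) := by
          simp only [add_mul, mul_add, Finset.sum_add_distrib, Finset.sum_mul, Finset.mul_sum,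
            sum_sum_mul_comm]
          congr 1
          exact Finset.sum_congr rfl fun x _ => by ring
      _ = ∑ x ∈ vertices, weight x * 3 :=
          Finset.sum_congr rfl fun x hx => by rw [hg.sum_indicator hx]
      _ = 0 := by rw [← Finset.sum_mul, sum_weight, zero_mul]
  have h_one : b one = 1 := by simp [hb, toQuaternion_one]
  by_contra h
  have h_neg : b (neg one) = 0 := by simp [hb, toQuaternion_neg, toQuaternion_one, h]
  omega

theorem apply_neg_of_isProper {x : Icosian} (hx : x ∈ vertices) {g : Quaternion ℝ → Fin 5}
    (hg : IsProper g) : g (-toQuaternion x) = g (toQuaternion x) := by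
  induction hk : height x using Nat.strong_induction_on generalizing x g with
  | _ k ih =>
    rcases exists_height_mul_lt x hx with rfl | ⟨t, ht, hlt⟩
    · rw [toQuaternion_one]
      exact hg.apply_neg_one
    · have hy := mul_mem x hx t ht
      have hs := conj_mem_units t ht
      have h := ih _ (hk ▸ hlt) hy (hg.mul_right hs) rfl
      simp only [neg_mul] at h
      rwa [← toQuaternion_mul hy hs, mul_mul_conj hx ht] at h

theorem isSign_iff {ε : ℝ} : IsSign ε ↔ ∃ e ∈ signs, ε = (e : ℝ) := by
  simp [IsSign, signs]

theorem mem_evenMaps : ∀ m : Fin 4 → Fin 4,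
    m ∈ evenMaps ↔ ∃ σ : Equiv.Perm (Fin 4), Equiv.Perm.sign σ = 1 ∧ m = σ := by
  decide +kernel

theorem coords_toQuaternion_ofCoords (p : Fin 4 → ℤ × ℤ) :
    coords (toQuaternion (ofCoords p)) = fun i => ((p i).1 + (p i).2 * gr) / 2 := by
  ext i
  fin_cases i <;> rfl

theorem coords_injective : Function.Injective coords := by
  intro p q h
  ext
  exacts [congrFun h 0, congrFun h 1, congrFun h 2, congrFun h 3]

theorem inv_two_mul_gr (e : ℝ) : e / (2 * gr) = (-e + e * gr) / 2 := by
  have := one_lt_gr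
  rw [div_eq_div_iff (by positivity) two_ne_zero]
  linear_combination -2 * e * gr_sq

theorem coords_ofCoords_axis (e : ℤ) :
    coords (toQuaternion (ofCoords ![(2 * e, 0), 0, 0, 0])) = ![(e : ℝ), 0, 0, 0] ∧
    coords (toQuaternion (ofCoords ![0, (2 * e, 0), 0, 0])) = ![0, (e : ℝ), 0, 0] ∧
    coords (toQuaternion (ofCoords ![0, 0, (2 * e, 0), 0])) = ![0, 0, (e : ℝ), 0] ∧
    coords (toQuaternion (ofCoords ![0, 0, 0, (2 * e, 0)])) = ![0, 0, 0, (e : ℝ)] := by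
  simp only [coords_toQuaternion_ofCoords]
  refine ⟨?_, ?_, ?_, ?_⟩ <;> ext i <;> fin_cases i <;> simp

theorem coords_ofCoords_half (e₀ e₁ e₂ e₃ : ℤ) :
    coords (toQuaternion (ofCoords ![(e₀, 0), (e₁, 0), (e₂, 0), (e₃, 0)])) =
      ![(e₀ : ℝ) / 2, (e₁ : ℝ) / 2, (e₂ : ℝ) / 2, (e₃ : ℝ) / 2] := by
  rw [coords_toQuaternion_ofCoords]
  ext i
  fin_cases i <;> simp

theorem coords_ofCoords_golden (e₁ e₂ e₃ : ℤ) (m : Fin 4 → Fin 4) :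
    coords (toQuaternion (ofCoords (![(0, e₁), (e₂, 0), (-e₃, e₃), 0] ∘ m))) =
      ![(e₁ : ℝ) * gr / 2, (e₂ : ℝ) / 2, (e₃ : ℝ) / (2 * gr), 0] ∘ m := by
  rw [coords_toQuaternion_ofCoords]
  ext i
  simp only [Function.comp_apply]
  generalize m i = j
  fin_cases j <;> simp [inv_two_mul_gr]

theorem toQuaternion_mem {x : Icosian} (hx : x ∈ vertices) : toQuaternion x ∈ V600 := by
  rcases mem_vertices.1 hx with ⟨e, he, h⟩ | ⟨e₀, h₀, e₁, h₁, e₂, h₂, e₃, h₃, rfl⟩ |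
    ⟨e₁, h₁, e₂, h₂, e₃, h₃, m, hm, rfl⟩
  · obtain ⟨k₀, k₁, k₂, k₃⟩ := coords_ofCoords_axis e
    refine Or.inl ⟨e, isSign_iff.2 ⟨e, he, rfl⟩, ?_⟩
    rcases h with rfl | rfl | rfl | rfl
    exacts [Or.inl k₀, Or.inr (Or.inl k₁), Or.inr (Or.inr (Or.inl k₂)),
      Or.inr (Or.inr (Or.inr k₃))]
  · exact Or.inr (Or.inl ⟨e₀, e₁, e₂, e₃, isSign_iff.2 ⟨_, h₀, rfl⟩, isSign_iff.2 ⟨_, h₁, rfl⟩,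
      isSign_iff.2 ⟨_, h₂, rfl⟩, isSign_iff.2 ⟨_, h₃, rfl⟩, coords_ofCoords_half ..⟩)
  · obtain ⟨σ, hσ, rfl⟩ := (mem_evenMaps m).1 hm
    exact Or.inr (Or.inr ⟨e₁, e₂, e₃, isSign_iff.2 ⟨_, h₁, rfl⟩, isSign_iff.2 ⟨_, h₂, rfl⟩,
      isSign_iff.2 ⟨_, h₃, rfl⟩, σ, hσ, coords_ofCoords_golden ..⟩)

theorem exists_toQuaternion_eq {q : Quaternion ℝ} (hq : q ∈ V600) :
    ∃ x ∈ vertices, toQuaternion x = q := by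
  rcases hq with ⟨ε, hε, h⟩ | ⟨ε₀, ε₁, ε₂, ε₃, h₀, h₁, h₂, h₃, h⟩ |
    ⟨ε₁, ε₂, ε₃, h₁, h₂, h₃, σ, hσ, h⟩
  · obtain ⟨e, he, rfl⟩ := isSign_iff.1 hε
    obtain ⟨k₀, k₁, k₂, k₃⟩ := coords_ofCoords_axis e
    rcases h with h | h | h | h
    · exact ⟨_, mem_vertices.2 (Or.inl ⟨e, he, Or.inl rfl⟩), coords_injective (k₀.trans h.symm)⟩
    · exact ⟨_, mem_vertices.2 (Or.inl ⟨e, he, Or.inr (Or.inl rfl)⟩),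
        coords_injective (k₁.trans h.symm)⟩
    · exact ⟨_, mem_vertices.2 (Or.inl ⟨e, he, Or.inr (Or.inr (Or.inl rfl))⟩),
        coords_injective (k₂.trans h.symm)⟩
    · exact ⟨_, mem_vertices.2 (Or.inl ⟨e, he, Or.inr (Or.inr (Or.inr rfl))⟩),
        coords_injective (k₃.trans h.symm)⟩
  · obtain ⟨e₀, k₀, rfl⟩ := isSign_iff.1 h₀
    obtain ⟨e₁, k₁, rfl⟩ := isSign_iff.1 h₁
    obtain ⟨e₂, k₂, rfl⟩ := isSign_iff.1 h₂
    obtain ⟨e₃, k₃, rfl⟩ := isSign_iff.1 h₃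
    exact ⟨_, mem_vertices.2 (Or.inr (Or.inl ⟨e₀, k₀, e₁, k₁, e₂, k₂, e₃, k₃, rfl⟩)),
      coords_injective ((coords_ofCoords_half ..).trans h.symm)⟩
  · obtain ⟨e₁, k₁, rfl⟩ := isSign_iff.1 h₁
    obtain ⟨e₂, k₂, rfl⟩ := isSign_iff.1 h₂
    obtain ⟨e₃, k₃, rfl⟩ := isSign_iff.1 h₃
    exact ⟨_, mem_vertices.2 (Or.inr (Or.inr ⟨e₁, k₁, e₂, k₂, e₃, k₃, σ,
      (mem_evenMaps σ).2 ⟨σ, hσ, rfl⟩, rfl⟩)),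
      coords_injective ((coords_ofCoords_golden ..).trans h.symm)⟩

end Icosian

/-- In every proper 5-coloring of the 600-cell graph, antipodal vertices receive the same
color. -/
theorem antipodal_same_color (f : V600 → Fin 5)
    (hf : ∀ q q' : V600, sigma600.Adj q q' → f q ≠ f q') :
    ∀ q q' : V600, (q' : Quaternion ℝ) = -(q : Quaternion ℝ) → f q' = f q := by
  classical
  intro q q' hqq'
  set g : Quaternion ℝ → Fin 5 := fun p => if h : p ∈ V600 then f ⟨p, h⟩ else 0 with hg
  have h_apply (p : V600) : g p = f p := by simp [hg]
  have h_proper : Icosian.IsProper g := by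
    intro x hx y hy hxy
    have h := hf ⟨_, Icosian.toQuaternion_mem hx⟩ ⟨_, Icosian.toQuaternion_mem hy⟩
    rw [← h_apply, ← h_apply] at h
    refine h ((SimpleGraph.fromRel_adj ..).2 ⟨fun heq => ?_, Or.inl hxy⟩)
    rw [Subtype.mk.injEq] at heq
    rw [heq, sub_self, norm_zero] at hxy
    linarith [Icosian.one_lt_gr]
  obtain ⟨x, hx, hxq⟩ := Icosian.exists_toQuaternion_eq q.2
  have h := Icosian.apply_neg_of_isProper hx h_proper
  rwa [hxq, ← hqq', h_apply, h_apply] at h
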